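/- arXiv:2605.16685 — 3 statements merged into one kernel-verified Lean document; each statement's English description precedes it below -/
import Mathlib

section
/- Let y* : ℝ^{d_x} → ℝ^{d_y} be L_y-Lipschitz and let μ > 0. Then the smoothed response y_μ is continuously differentiable on ℝ^{d_x}, and for every x its Jacobian matrix satisfies Jac y_μ(x) = (d_x/μ) · E_{v ~ U(S^{d_x})}[ y*(x + μ v) vᵀ ], where the expectation is taken entrywise. -/
open MeasureTheory Metric
open scoped InnerProductSpace RealInnerProductSpace NNReal

noncomputable section

/-- `ℝ^n` with the Euclidean norm. -/
abbrev E (n : ℕ) : Type := EuclideanSpace ℝ (Fin n)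

/-- Uniform (normalized Lebesgue) probability measure on the closed unit ball of `ℝ^n`. -/
def uniformBall (n : ℕ) : Measure (E n) :=
  (volume (closedBall (0 : E n) 1))⁻¹ • volume.restrict (closedBall (0 : E n) 1)

/-- Uniform (rotation-invariant) probability measure on the unit sphere of `ℝ^n`,
viewed as a measure on the ambient space. -/
def uniformSphere (n : ℕ) : Measure (E n) :=
  ((volume : Measure (E n)).toSphere Set.univ)⁻¹ •
    Measure.map Subtype.val ((volume : Measure (E n)).toSphere)

/-- Ball smoothing `y_μ` of a map `y : ℝ^{d_x} → ℝ^{d_y}`: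
`y_μ(x) = E_{u ~ U(B^{d_x})}[y(x + μ u)]`. -/
def ymu {dx dy : ℕ} (y : E dx → E dy) (μ : ℝ) (x : E dx) : E dy :=
  ∫ u, y (x + μ • u) ∂(uniformBall dx)

/-- Partial gradient `∇_x f` of `f : ℝ^{d_x} × ℝ^{d_y} → ℝ` in its first argument. -/
def gradx {dx dy : ℕ} (f : E dx × E dy → ℝ) (x : E dx) (y : E dy) : E dx :=
  gradient (fun x' => f (x', y)) x

/-- Partial gradient `∇_y f` of `f : ℝ^{d_x} × ℝ^{d_y} → ℝ` in its second argument. -/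
def grady {dx dy : ℕ} (f : E dx × E dy → ℝ) (x : E dx) (y : E dy) : E dy :=
  gradient (fun y' => f (x, y')) y

/-- Smoothed surrogate `F_μ(x) = f(x, y_μ(x))`. -/
def Fmu {dx dy : ℕ} (f : E dx × E dy → ℝ) (y : E dx → E dy) (μ : ℝ) (x : E dx) : ℝ :=
  f (x, ymu y μ x)

section SphereCalculus

open Set Filter Topology Module

theorem integral_eq_integral_Ioi_toSphere {V F : Type*} [NormedAddCommGroup V] [NormedSpace ℝ V]
    [FiniteDimensional ℝ V] [Nontrivial V] [MeasurableSpace V] [BorelSpace V]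
    [NormedAddCommGroup F] [NormedSpace ℝ F] (μ : Measure V) [μ.IsAddHaarMeasure]
    {g : V → F} (hg : Integrable g μ) :
    ∫ x, g x ∂μ = ∫ t in Ioi (0 : ℝ), t ^ (finrank ℝ V - 1) •
      ∫ v : sphere (0 : V) 1, g (t • (v : V)) ∂μ.toSphere := by
  have hmp := μ.measurePreserving_homeomorphUnitSphereProd
  have hemb := (homeomorphUnitSphereProd V).measurableEmbedding
  let G : sphere (0 : V) 1 × Ioi (0 : ℝ) → F := fun p ↦ g (p.2.1 • p.1.1)
  have hG : ∀ x : ({0}ᶜ : Set V), G (homeomorphUnitSphereProd V x) = g x := by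
    intro x
    have h : x.1 ≠ 0 := x.2
    simp [G, smul_smul, h]
  have hGint : Integrable G (μ.toSphere.prod (.volumeIoiPow (finrank ℝ V - 1))) := by
    rw [← hmp.integrable_comp_emb hemb]
    have : G ∘ homeomorphUnitSphereProd V = g ∘ Subtype.val := funext hG
    rw [this, ← integrableOn_iff_comap_subtypeVal (measurableSet_singleton _).compl]
    exact hg.integrableOn
  calc
    ∫ x, g x ∂μ = ∫ x : ({(0)}ᶜ : Set V), g x ∂(μ.comap (↑)) := by
      rw [integral_subtype_comap (measurableSet_singleton _).compl g,
        restrict_compl_singleton]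
    _ = ∫ p, G p ∂μ.toSphere.prod (.volumeIoiPow (finrank ℝ V - 1)) := by
      rw [← hmp.integral_comp hemb]
      simp_rw [hG]
    _ = ∫ t : Ioi (0 : ℝ), ∫ v, G (v, t) ∂μ.toSphere ∂.volumeIoiPow (finrank ℝ V - 1) :=
      integral_prod_symm _ hGint
    _ = _ := by
      simp only [Measure.volumeIoiPow, ENNReal.ofReal, G]
      rw [integral_withDensity_eq_integral_smul,
        integral_subtype_comap measurableSet_Ioi fun a ↦ Real.toNNReal (a ^ (finrank ℝ V - 1)) •
          ∫ v : sphere (0 : V) 1, g (a • (v : V)) ∂μ.toSphere,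
        setIntegral_congr_fun measurableSet_Ioi fun x hx ↦ ?_]
      · rw [NNReal.smul_def, Real.coe_toNNReal _ (pow_nonneg hx.out.le _)]
      · exact (measurable_subtype_coe.pow_const _).real_toNNReal

theorem setIntegral_ball_eq_intervalIntegral_toSphere {V F : Type*} [NormedAddCommGroup V]
    [NormedSpace ℝ V] [FiniteDimensional ℝ V] [Nontrivial V] [MeasurableSpace V] [BorelSpace V]
    [NormedAddCommGroup F] [NormedSpace ℝ F] (μ : Measure V) [μ.IsAddHaarMeasure]
    {g : V → F} {r : ℝ} (hr : 0 ≤ r) (hg : IntegrableOn g (ball 0 r) μ) :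
    ∫ x in ball 0 r, g x ∂μ = ∫ t in 0..r, t ^ (finrank ℝ V - 1) •
      ∫ v : sphere (0 : V) 1, g (t • (v : V)) ∂μ.toSphere := by
  rw [← integral_indicator measurableSet_ball,
    integral_eq_integral_Ioi_toSphere μ (hg.integrable_indicator measurableSet_ball),
    intervalIntegral.integral_of_le hr, integral_Ioc_eq_integral_Ioo,
    ← Ioi_inter_Iio, ← setIntegral_indicator measurableSet_Iio]
  refine setIntegral_congr_fun measurableSet_Ioi fun t ht ↦ ?_
  have ht0 : 0 < t := ht
  by_cases htr : t < r <;> simp [indicator, norm_smul, abs_of_pos ht0, htr]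

theorem hasDerivAt_integral_posPart_smul {V F : Type*} [TopologicalSpace V] [T2Space V]
    [MeasurableSpace V] [BorelSpace V] [SecondCountableTopology V]
    [NormedAddCommGroup F] [NormedSpace ℝ F] {ν : Measure V} [IsFiniteMeasureOnCompacts ν]
    {f : V → F} (hf : Continuous f) {q q' : ℝ → V → ℝ} {t₀ C : ℝ} {K : Set V}
    (hK : IsCompact K) (hq : ∀ t, Continuous (q t)) (hq'c : Continuous (q' t₀))
    (hq' : ∀ t u, HasDerivAt (q · u) (q' t u) t)
    (hC : ∀ t ∈ ball t₀ 1, ∀ u ∈ K, |q' t u| ≤ C)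
    (hqK : ∀ t ∈ ball t₀ 1, ∀ u ∉ K, q t u ≤ 0)
    (h0 : ∀ᵐ u ∂ν, q t₀ u ≠ 0) :
    HasDerivAt (fun t ↦ ∫ u, max (q t u) 0 • f u ∂ν)
      (∫ u in {u | 0 < q t₀ u}, q' t₀ u • f u ∂ν) t₀ := by
  have hpos : MeasurableSet {u | 0 < q t₀ u} :=
    (isOpen_lt continuous_const (hq t₀)).measurableSet
  have hcont : ∀ t, Continuous fun u ↦ max (q t u) 0 • f u := fun t ↦
    ((hq t).max continuous_const).smul hf
  rw [← integral_indicator hpos]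
  have hfK : IntegrableOn (fun u ↦ C * ‖f u‖) K ν :=
    (continuous_const.mul hf.norm).continuousOn.integrableOn_compact hK
  refine (hasDerivAt_integral_of_dominated_loc_of_lip (𝕜 := ℝ)
    (bound := K.indicator fun u ↦ C * ‖f u‖) (ball_mem_nhds t₀ one_pos)
    (.of_forall fun t ↦ (hcont t).aestronglyMeasurable) ?_ ?_ ?_ ?_ ?_).2
  · refine (hcont t₀).integrable_of_hasCompactSupport (.intro hK fun u hu ↦ ?_)
    simp [hqK t₀ (mem_ball_self one_pos) u hu]
  · exact (hq'c.smul hf).aestronglyMeasurable.indicator hpos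
  · refine .of_forall fun u ↦ LipschitzOnWith.of_dist_le_mul fun s hs t ht ↦ ?_
    by_cases hu : u ∈ K
    · have hC0 : 0 ≤ C := (abs_nonneg _).trans (hC s hs u hu)
      have h1 : ‖q s u - q t u‖ ≤ C * ‖s - t‖ :=
        (convex_ball t₀ 1).norm_image_sub_le_of_norm_hasDerivWithin_le
          (fun z _ ↦ (hq' z u).hasDerivWithinAt) (fun z hz ↦ hC z hz u hu) ht hs
      have h2 : |max (q s u) 0 - max (q t u) 0| ≤ |q s u - q t u| :=
        abs_max_sub_max_le_abs _ _ _
      rw [dist_eq_norm, ← sub_smul, norm_smul, indicator_of_mem hu, Real.coe_nnabs,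
        abs_of_nonneg (by positivity), Real.dist_eq, Real.norm_eq_abs]
      simp only [Real.norm_eq_abs] at h1
      calc |max (q s u) 0 - max (q t u) 0| * ‖f u‖ ≤ C * |s - t| * ‖f u‖ := by
            gcongr; exact h2.trans h1
        _ = C * ‖f u‖ * |s - t| := by ring
    · simp [hqK s hs u hu, hqK t ht u hu, hu]
  · exact hfK.integrable_indicator hK.measurableSet
  · filter_upwards [h0] with u hu
    rcases hu.lt_or_gt with h | h
    · rw [indicator_of_notMem (by simpa using h.le)]
      refine (hasDerivAt_const t₀ (0 : F)).congr_of_eventuallyEq ?_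
      filter_upwards [(hq' t₀ u).continuousAt.eventually_lt continuousAt_const h] with t ht
      simp [ht.le]
    · rw [indicator_of_mem (by simpa using h)]
      refine ((hq' t₀ u).smul_const (f u)).congr_of_eventuallyEq ?_
      filter_upwards [continuousAt_const.eventually_lt (hq' t₀ u).continuousAt h] with t ht
      simp [ht.le]

section Flux

variable {V F : Type*} [NormedAddCommGroup V] [InnerProductSpace ℝ V] [FiniteDimensional ℝ V]
  [MeasurableSpace V] [BorelSpace V] [NormedAddCommGroup F] [NormedSpace ℝ F]

/-- The flux of `f` through the sphere of radius `t` centred at `x`, normalised by `t ^ (dim V - 1)`: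
the linear map sending `w` to `∫ v, ⟪v, w⟫ • f (x + t • v)`. -/
def sphereFlux (f : V → F) (t : ℝ) (x : V) : V →L[ℝ] F :=
  ∫ v : sphere (0 : V) 1, (innerSL ℝ (v : V)).smulRight (f (x + t • (v : V)))
    ∂(volume : Measure V).toSphere

theorem continuous_sphereFlux {f : V → F} (hf : Continuous f) :
    Continuous fun p : ℝ × V ↦ sphereFlux f p.1 p.2 := by
  have : ProperSpace V := FiniteDimensional.proper_real V
  have : SecondCountableTopologyEither (sphere (0 : V) 1) (V →L[ℝ] F) := ⟨.inl inferInstance⟩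
  have h : Continuous (Function.uncurry fun (p : ℝ × V) (v : sphere (0 : V) 1) ↦
      (innerSL ℝ (v : V)).smulRight (f (p.2 + p.1 • (v : V)))) := by
    have h1 : Continuous fun z : (ℝ × V) × sphere (0 : V) 1 ↦ innerSL ℝ (z.2 : V) := by fun_prop
    have h2 : Continuous fun z : (ℝ × V) × sphere (0 : V) 1 ↦ f (z.1.2 + z.1.1 • (z.2 : V)) := by
      fun_prop
    exact ((ContinuousLinearMap.smulRightL ℝ V F).continuous.comp h1).clm_apply h2
  simpa [sphereFlux] using continuous_parametric_integral_of_continuous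
    (μ := (volume : Measure V).toSphere) h isCompact_univ

theorem sphereFlux_apply {f : V → F} (hf : Continuous f) (t : ℝ) (x w : V) :
    sphereFlux f t x w = ∫ v : sphere (0 : V) 1, ⟪(v : V), w⟫_ℝ • f (x + t • (v : V))
      ∂(volume : Measure V).toSphere := by
  have : ProperSpace V := FiniteDimensional.proper_real V
  have : SecondCountableTopologyEither (sphere (0 : V) 1) (V →L[ℝ] F) := ⟨.inl inferInstance⟩
  have h : Continuous fun v : sphere (0 : V) 1 ↦
      (innerSL ℝ (v : V)).smulRight (f (x + t • (v : V))) := by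
    have h1 : Continuous fun v : sphere (0 : V) 1 ↦ innerSL ℝ (v : V) := by fun_prop
    have h2 : Continuous fun v : sphere (0 : V) 1 ↦ f (x + t • (v : V)) := by fun_prop
    exact ((ContinuousLinearMap.smulRightL ℝ V F).continuous.comp h1).clm_apply h2
  rw [sphereFlux, ContinuousLinearMap.integral_apply
    (h.integrable_of_hasCompactSupport (.of_compactSpace _))]
  simp

theorem setOf_pos_sq_sub_norm_sq {V : Type*} [SeminormedAddCommGroup V] (x : V) {r : ℝ}
    (hr : 0 < r) : {u : V | 0 < r ^ 2 - ‖u - x‖ ^ 2} = ball x r := by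
  ext u
  simp [mem_ball, dist_eq_norm, sq_lt_sq₀ (norm_nonneg _) hr.le]

theorem ae_sq_sub_norm_sq_ne_zero (x : V) {r : ℝ} (hr : 0 < r) :
    ∀ᵐ u : V, r ^ 2 - ‖u - x‖ ^ 2 ≠ 0 := by
  refine measure_mono_null (fun u hu ↦ ?_)
    (Measure.addHaar_sphere_of_ne_zero (volume : Measure V) x hr.ne')
  simp only [mem_compl_iff, mem_ofPred_eq, not_not, sub_eq_zero] at hu
  rw [mem_sphere, dist_eq_norm]
  exact ((sq_eq_sq₀ hr.le (norm_nonneg _)).1 hu).symm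

/-- The integral of `f` against the paraboloid kernel `max (r² - ‖u - x‖²) 0`. -/
def paraboloidIntegral (f : V → F) (r : ℝ) (x : V) : F :=
  ∫ u, max (r ^ 2 - ‖u - x‖ ^ 2) 0 • f u

theorem hasDerivAt_paraboloidIntegral_radius {f : V → F} (hf : Continuous f) (x : V) {r : ℝ}
    (hr : 0 < r) :
    HasDerivAt (paraboloidIntegral f · x) ((2 * r) • ∫ u in ball x r, f u) r := by
  have h := hasDerivAt_integral_posPart_smul (ν := (volume : Measure V)) hf
    (q := fun t u ↦ t ^ 2 - ‖u - x‖ ^ 2) (q' := fun t _ ↦ 2 * t) (t₀ := r) (C := 2 * (r + 1))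
    (isCompact_closedBall x (r + 1)) (fun t ↦ by fun_prop) (by fun_prop)
    (fun t u ↦ by simpa using (hasDerivAt_pow 2 t).sub_const (‖u - x‖ ^ 2))
    (fun t ht u _ ↦ ?_) (fun t ht u hu ↦ ?_) (ae_sq_sub_norm_sq_ne_zero x hr)
  · rwa [setOf_pos_sq_sub_norm_sq x hr, integral_smul] at h
  · rw [mem_ball, Real.dist_eq, abs_lt] at ht
    rw [abs_le]
    constructor <;> linarith
  · rw [mem_ball, Real.dist_eq, abs_lt] at ht
    rw [mem_closedBall, dist_eq_norm, not_le] at hu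
    nlinarith

theorem hasDerivAt_paraboloidIntegral_translate {f : V → F} (hf : Continuous f) (x w : V) {r : ℝ}
    (hr : 0 < r) (s : ℝ) :
    HasDerivAt (fun s : ℝ ↦ paraboloidIntegral f r (x + s • w))
      (∫ u in ball (x + s • w) r, (2 * ⟪u - (x + s • w), w⟫_ℝ) • f u) s := by
  have hder : ∀ (t : ℝ) (u : V), HasDerivAt (fun t : ℝ ↦ r ^ 2 - ‖u - (x + t • w)‖ ^ 2)
      (2 * ⟪u - (x + t • w), w⟫_ℝ) t := by
    intro t u
    have h1 : HasDerivAt (fun t : ℝ ↦ u - (x + t • w)) (-w) t := by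
      simpa using (((hasDerivAt_id t).smul_const w).const_add x).const_sub u
    simpa using h1.norm_sq.const_sub (r ^ 2)
  have hdist : ∀ t ∈ ball s 1, ‖t • w - s • w‖ ≤ ‖w‖ := by
    intro t ht
    rw [mem_ball, Real.dist_eq] at ht
    rw [← sub_smul, norm_smul, Real.norm_eq_abs]
    nlinarith [norm_nonneg w]
  have h := hasDerivAt_integral_posPart_smul (ν := (volume : Measure V)) hf
    (q := fun t u ↦ r ^ 2 - ‖u - (x + t • w)‖ ^ 2)
    (q' := fun t u ↦ 2 * ⟪u - (x + t • w), w⟫_ℝ) (t₀ := s)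
    (C := 2 * ((r + ‖w‖ + ‖w‖) * ‖w‖))
    (isCompact_closedBall (x + s • w) (r + ‖w‖)) (fun t ↦ by fun_prop) (by fun_prop)
    hder (fun t ht u hu ↦ ?_) (fun t ht u hu ↦ ?_) (ae_sq_sub_norm_sq_ne_zero (x + s • w) hr)
  · rwa [setOf_pos_sq_sub_norm_sq _ hr] at h
  · rw [mem_closedBall, dist_eq_norm] at hu
    have h1 : ‖u - (x + t • w)‖ ≤ r + ‖w‖ + ‖w‖ := by
      calc ‖u - (x + t • w)‖ = ‖(u - (x + s • w)) - (t • w - s • w)‖ := by congr 1; abel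
        _ ≤ _ := (norm_sub_le _ _).trans (add_le_add hu (hdist t ht))
    rw [abs_mul, abs_two]
    gcongr
    exact (abs_real_inner_le_norm _ _).trans (by gcongr)
  · rw [mem_closedBall, dist_eq_norm, not_le] at hu
    have h1 : r ≤ ‖u - (x + t • w)‖ := by
      have h2 : ‖u - (x + s • w)‖ ≤ ‖u - (x + t • w)‖ + ‖t • w - s • w‖ := by
        calc ‖u - (x + s • w)‖ = ‖(u - (x + t • w)) + (t • w - s • w)‖ := by congr 1; abel
          _ ≤ _ := norm_add_le _ _
      linarith [hdist t ht]
    nlinarith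

theorem setIntegral_ball_inner_smul_eq_intervalIntegral [Nontrivial V] {f : V → F}
    (hf : Continuous f) (y w : V) {r : ℝ} (hr : 0 ≤ r) :
    ∫ u in ball y r, (2 * ⟪u - y, w⟫_ℝ) • f u =
      ∫ t in 0..r, (2 * t ^ finrank ℝ V) • sphereFlux f t y w := by
  have htr : ∫ u in ball y r, (2 * ⟪u - y, w⟫_ℝ) • f u =
      ∫ u in ball (0 : V) r, (2 * ⟪u, w⟫_ℝ) • f (y + u) := by
    rw [← integral_indicator measurableSet_ball, ← integral_indicator measurableSet_ball,
      ← integral_add_left_eq_self _ y]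
    refine integral_congr_ae (.of_forall fun u ↦ ?_)
    simp [indicator, mem_ball, dist_eq_norm]
  have hc : Continuous fun u : V ↦ (2 * ⟪u, w⟫_ℝ) • f (y + u) := by fun_prop
  rw [htr, setIntegral_ball_eq_intervalIntegral_toSphere volume hr
    ((hc.continuousOn.integrableOn_compact (isCompact_closedBall 0 r)).mono_set
      ball_subset_closedBall)]
  refine intervalIntegral.integral_congr fun t _ ↦ ?_
  simp only [sphereFlux_apply hf, inner_smul_left]
  rw [← integral_smul, ← integral_smul]
  refine integral_congr_ae (.of_forall fun v ↦ ?_)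
  have hn : t ^ finrank ℝ V = t ^ (finrank ℝ V - 1) * t := by
    rw [← pow_succ, Nat.sub_add_cancel finrank_pos]
  simp only [smul_smul, hn, conj_trivial]
  congr 1
  ring

theorem setIntegral_ball_add_sub_setIntegral_ball [Nontrivial V] [CompleteSpace F] {f : V → F}
    (hf : Continuous f) (x w : V) {r : ℝ} (hr : 0 < r) :
    (∫ u in ball (x + w) r, f u) - ∫ u in ball x r, f u =
      ∫ s in (0 : ℝ)..1, r ^ (finrank ℝ V - 1) • sphereFlux f r (x + s • w) w := by
  set n := finrank ℝ V
  have hflux : Continuous fun p : ℝ × ℝ ↦ (2 * p.2 ^ n) • sphereFlux f p.2 (x + p.1 • w) w :=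
    (by fun_prop : Continuous fun p : ℝ × ℝ ↦ 2 * p.2 ^ n).smul
      (((continuous_sphereFlux hf).comp
        (by fun_prop : Continuous fun p : ℝ × ℝ ↦ (p.2, x + p.1 • w))).clm_apply continuous_const)
  have hinner : Continuous fun t : ℝ ↦ ∫ s in (0 : ℝ)..1,
      (2 * t ^ n) • sphereFlux f t (x + s • w) w :=
    intervalIntegral.continuous_parametric_intervalIntegral_of_continuous'
      (f := fun t s ↦ (2 * t ^ n) • sphereFlux f t (x + s • w) w)
      (hflux.comp continuous_swap) 0 1
  have hdiff : ∀ t, 0 < t → paraboloidIntegral f t (x + w) - paraboloidIntegral f t x =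
      ∫ t' in 0..t, ∫ s in (0 : ℝ)..1, (2 * t' ^ n) • sphereFlux f t' (x + s • w) w := by
    intro t ht
    have hder := hasDerivAt_paraboloidIntegral_translate hf x w ht
    simp_rw [setIntegral_ball_inner_smul_eq_intervalIntegral hf _ _ ht.le] at hder
    have hcont : Continuous fun s : ℝ ↦
        ∫ t' in 0..t, (2 * t' ^ n) • sphereFlux f t' (x + s • w) w :=
      intervalIntegral.continuous_parametric_intervalIntegral_of_continuous' hflux 0 t
    have hftc := intervalIntegral.integral_eq_sub_of_hasDerivAt (a := 0) (b := 1)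
      (fun s _ ↦ hder s) (hcont.intervalIntegrable 0 1)
    rw [intervalIntegral_intervalIntegral_swap] at hftc
    · simpa using hftc.symm
    · exact (hflux.continuousOn.integrableOn_compact
        (isCompact_uIcc.prod isCompact_uIcc)).mono_set
          (prod_mono uIoc_subset_uIcc uIoc_subset_uIcc)
  have h1 := (hasDerivAt_paraboloidIntegral_radius hf (x + w) hr).sub
    (hasDerivAt_paraboloidIntegral_radius hf x hr)
  have h2 : HasDerivAt (fun t ↦ ∫ t' in 0..t, ∫ s in (0 : ℝ)..1,
      (2 * t' ^ n) • sphereFlux f t' (x + s • w) w) _ r :=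
    (hinner.integral_hasStrictDerivAt 0 r).hasDerivAt
  have h3 := h1.unique (h2.congr_of_eventuallyEq
    ((eventually_gt_nhds hr).mono fun t ht ↦ hdiff t ht))
  have hn : 2 * r ^ n = (2 * r) * r ^ (n - 1) := by
    rw [mul_assoc, ← pow_succ', Nat.sub_add_cancel finrank_pos]
  rw [← smul_sub] at h3
  simp_rw [hn, mul_smul (2 * r)] at h3
  rw [intervalIntegral.integral_smul] at h3
  exact smul_right_injective F (by positivity : 2 * r ≠ 0) h3

theorem hasFDerivAt_of_forall_sub_eq_intervalIntegral {V F : Type*} [NormedAddCommGroup V]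
    [NormedSpace ℝ V] [NormedAddCommGroup F] [NormedSpace ℝ F] [CompleteSpace F]
    {g : V → F} {L : V → V →L[ℝ] F} (hL : Continuous L)
    (h : ∀ x w, g (x + w) - g x = ∫ s in (0 : ℝ)..1, L (x + s • w) w) (x : V) :
    HasFDerivAt g (L x) x := by
  rw [hasFDerivAt_iff_isLittleO_nhds_zero, Asymptotics.isLittleO_iff]
  intro c hc
  obtain ⟨δ, hδ, hLδ⟩ := Metric.continuousAt_iff.1 hL.continuousAt c hc
  filter_upwards [ball_mem_nhds (0 : V) hδ] with w hw
  rw [mem_ball_zero_iff] at hw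
  have hint : IntervalIntegrable (fun s : ℝ ↦ L (x + s • w) w) volume 0 1 :=
    Continuous.intervalIntegrable (by fun_prop) 0 1
  have heq : g (x + w) - g x - L x w = ∫ s in (0 : ℝ)..1, (L (x + s • w) w - L x w) := by
    rw [intervalIntegral.integral_sub hint intervalIntegrable_const, ← h]
    simp
  rw [heq]
  refine (intervalIntegral.norm_integral_le_of_norm_le_const (C := c * ‖w‖) fun s hs ↦ ?_).trans
    (by simp)
  rw [uIoc_of_le zero_le_one] at hs
  rw [← sub_apply]
  refine ContinuousLinearMap.le_of_opNorm_le _ ?_ w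
  rw [← dist_eq_norm]
  refine (hLδ ?_).le
  rw [dist_eq_norm, add_sub_cancel_left, norm_smul, Real.norm_eq_abs, abs_of_pos hs.1]
  nlinarith [hs.2, norm_nonneg w]

end Flux

/-- Ball smoothing as a rescaled integral over the ball `ball x μ`. -/
theorem ymu_eq_smul_setIntegral_ball {dx dy : ℕ} (y : E dx → E dy) {μ : ℝ} (hμ : 0 < μ)
    (x : E dx) :
    ymu y μ x = ((volume.real (closedBall (0 : E dx) 1))⁻¹ * (μ ^ dx)⁻¹) •
      ∫ u in ball x μ, y u := by
  have htr : ∫ u in closedBall (0 : E dx) μ, y (x + u) = ∫ u in ball x μ, y u := by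
    have hae : (ball x μ : Set (E dx)) =ᵐ[volume] closedBall x μ := by
      rw [← ball_union_sphere]
      exact (union_ae_eq_left_of_ae_eq_empty (ae_eq_empty.2
        (Measure.addHaar_sphere_of_ne_zero volume x hμ.ne'))).symm
    rw [setIntegral_congr_set hae,
      ← integral_indicator measurableSet_closedBall, ← integral_indicator measurableSet_closedBall,
      ← integral_add_left_eq_self ((closedBall x μ).indicator y) x]
    refine integral_congr_ae (.of_forall fun u ↦ ?_)
    simp [indicator, mem_closedBall, dist_eq_norm]
  rw [ymu, uniformBall, integral_smul_measure,
    Measure.setIntegral_comp_smul_of_pos volume (fun u ↦ y (x + u)) _ hμ,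
    _root_.smul_closedBall _ _ zero_le_one, smul_zero, Real.norm_of_nonneg hμ.le, mul_one, htr,
    smul_smul, ENNReal.toReal_inv, finrank_euclideanSpace_fin]
  rfl

theorem integral_uniformSphere {n : ℕ} [NeZero n] {F : Type*} [NormedAddCommGroup F]
    [NormedSpace ℝ F] (g : E n → F) :
    ∫ v, g v ∂(uniformSphere n) = (n * volume.real (closedBall (0 : E n) 1))⁻¹ •
      ∫ v : sphere (0 : E n) 1, g v ∂(volume : Measure (E n)).toSphere := by
  have hemb : MeasurableEmbedding (Subtype.val : sphere (0 : E n) 1 → E n) :=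
    .subtype_coe isClosed_sphere.measurableSet
  rw [uniformSphere, integral_smul_measure, hemb.integral_map, Measure.toSphere_apply_univ,
    ENNReal.toReal_inv, ENNReal.toReal_mul, finrank_euclideanSpace_fin,
    ← Measure.addHaar_closedBall_eq_addHaar_ball]
  simp [measureReal_def]

end SphereCalculus

/-- the smoothed response `y_μ` is continuously differentiable and its
Jacobian is `(d_x/μ) E_{v ~ U(S^{d_x})}[y*(x+μv) vᵀ]` (stated via its action on vectors:
the matrix `y*(x+μv) vᵀ` maps `w` to `⟪v, w⟫ • y*(x+μv)`). -/
theorem stmt1 (dx dy : ℕ) (ystar : E dx → E dy) (Ly : ℝ≥0)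
    (hLip : LipschitzWith Ly ystar) (μ : ℝ) (hμ : 0 < μ) :
    ContDiff ℝ 1 (ymu ystar μ) ∧
    ∀ (x : E dx) (w : E dx),
      fderiv ℝ (ymu ystar μ) x w
        = ((dx : ℝ) / μ) • ∫ v, ⟪v, w⟫_ℝ • ystar (x + μ • v) ∂(uniformSphere dx) := by
  rcases Nat.eq_zero_or_pos dx with rfl | hdx
  · refine ⟨?_, fun x w ↦ ?_⟩
    · rw [show ymu ystar μ = fun _ ↦ ymu ystar μ 0 from
        funext fun x ↦ congrArg _ (Subsingleton.elim x 0)]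
      exact contDiff_const
    · rw [Subsingleton.elim w 0]
      simp
  have : NeZero dx := ⟨hdx.ne'⟩
  have hcont := hLip.continuous
  set c : ℝ := volume.real (closedBall (0 : E dx) 1) with hc
  set L : E dx → E dx →L[ℝ] E dy := fun x ↦ (c⁻¹ * (μ ^ dx)⁻¹) •
    μ ^ (dx - 1) • sphereFlux ystar μ x with hL
  have hflux : Continuous (sphereFlux ystar μ) :=
    (continuous_sphereFlux hcont).comp (by fun_prop : Continuous fun x : E dx ↦ (μ, x))
  have hLcont : Continuous L :=
    (hflux.const_smul (μ ^ (dx - 1))).const_smul (c⁻¹ * (μ ^ dx)⁻¹)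
  have hderiv : ∀ x, HasFDerivAt (ymu ystar μ) (L x) x := by
    refine hasFDerivAt_of_forall_sub_eq_intervalIntegral hLcont fun x w ↦ ?_
    have h := setIntegral_ball_add_sub_setIntegral_ball hcont x w hμ
    rw [finrank_euclideanSpace_fin] at h
    rw [ymu_eq_smul_setIntegral_ball _ hμ, ymu_eq_smul_setIntegral_ball _ hμ, ← smul_sub, h,
      ← intervalIntegral.integral_smul]
    rfl
  have hfderiv : fderiv ℝ (ymu ystar μ) = L := funext fun x ↦ (hderiv x).fderiv
  refine ⟨contDiff_one_iff_fderiv.2 ⟨fun x ↦ (hderiv x).differentiableAt, hfderiv ▸ hLcont⟩,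
    fun x w ↦ ?_⟩
  have hpow : μ ^ dx = μ ^ (dx - 1) * μ := by rw [← pow_succ, Nat.sub_add_cancel hdx]
  rw [hfderiv, integral_uniformSphere, ← sphereFlux_apply hcont, hL]
  simp only [smul_apply, smul_smul]
  congr 1
  have hdx' : (dx : ℝ) ≠ 0 := by exact_mod_cast hdx.ne'
  rw [hpow, ← hc]
  field_simp
end
end

section
/- Let f : ℝ^{d_x} × ℝ^{d_y} → ℝ be differentiable with L_g-Lipschitz gradient and with ‖∇_y f(x,y)‖ ≤ L_f for all (x,y), and let y* : ℝ^{d_x} → ℝ^{d_y} be L_y-Lipschitz. Let μ > 0 and suppose k₁ > 0 is a constant with the property that for every L-Lipschitz scalar function h : ℝ^{d_x} → ℝ, the gradient of h_μ(x) = E_{u ~ U(B^{d_x})}[h(x + μ u)] is (k₁ L √d_x / μ)-Lipschitz. Then F_μ(x) = f(x, y_μ(x)) is differentiable with ∇F_μ(x) = ∇_x f(x, y_μ(x)) + Jac y_μ(x)ᵀ ∇_y f(x, y_μ(x)), and ∇F_μ is Lipschitz with constant L_F = L_g(1 + L_y)² + k₁ L_f L_y √d_x / μ. -/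
open MeasureTheory Metric
open scoped InnerProductSpace RealInnerProductSpace NNReal

noncomputable section

instance isProbabilityMeasure_uniformBall (n : ℕ) : IsProbabilityMeasure (uniformBall n) := by
  constructor
  have hpos : volume (closedBall (0 : E n) 1) ≠ 0 :=
    (measure_closedBall_pos _ _ one_pos).ne'
  have hfin : volume (closedBall (0 : E n) 1) ≠ ⊤ := measure_closedBall_lt_top.ne
  simpa [uniformBall] using ENNReal.inv_mul_cancel hpos hfin

lemma uniformBall_absolutelyContinuous (n : ℕ) : uniformBall n ≪ (volume : Measure (E n)) :=
  Measure.AbsolutelyContinuous.smul_left Measure.restrict_le_self.absolutelyContinuous _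

lemma ae_norm_le_one_uniformBall (n : ℕ) : ∀ᵐ u ∂(uniformBall n), ‖u‖ ≤ 1 := by
  refine Measure.ae_smul_measure ?_ _
  filter_upwards [ae_restrict_mem measurableSet_closedBall] with u hu
  simpa using hu

section Smoothing

variable {dx dy : ℕ} {y : E dx → E dy} {K : ℝ≥0} {μ : ℝ}

lemma integrable_comp_add_smul_uniformBall (hy : LipschitzWith K y) (μ : ℝ) (x : E dx) :
    Integrable (fun u => y (x + μ • u)) (uniformBall dx) := by
  have hcont : Continuous fun u : E dx => y (x + μ • u) := hy.continuous.comp (by fun_prop)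
  refine Integrable.of_bound hcont.aestronglyMeasurable (‖y x‖ + K * |μ|) ?_
  filter_upwards [ae_norm_le_one_uniformBall dx] with u hu
  have h1 : ‖y (x + μ • u) - y x‖ ≤ K * |μ| := by
    refine (hy.norm_sub_le _ _).trans ?_
    rw [add_sub_cancel_left, norm_smul, Real.norm_eq_abs]
    have := mul_le_of_le_one_right (abs_nonneg μ) hu
    gcongr
  calc ‖y (x + μ • u)‖ = ‖y x + (y (x + μ • u) - y x)‖ := by rw [add_sub_cancel]
    _ ≤ ‖y x‖ + ‖y (x + μ • u) - y x‖ := norm_add_le _ _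
    _ ≤ ‖y x‖ + K * |μ| := by gcongr

lemma ae_differentiableAt_add_smul_uniformBall (hy : LipschitzWith K y) (hμ : μ ≠ 0) (x : E dx) :
    ∀ᵐ u ∂(uniformBall dx), DifferentiableAt ℝ y (x + μ • u) := by
  refine (uniformBall_absolutelyContinuous dx).ae_le ?_
  have h0 : volume {z | ¬ DifferentiableAt ℝ y z} = 0 :=
    ae_iff.1 (hy.ae_differentiableAt (μ := (volume : Measure (E dx))))
  have h1 : volume ((x + ·) ⁻¹' {z | ¬ DifferentiableAt ℝ y z}) = 0 := by
    rw [measure_preimage_add, h0]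
  have h2 := Measure.addHaar_preimage_smul (volume : Measure (E dx)) hμ
    ((x + ·) ⁻¹' {z | ¬ DifferentiableAt ℝ y z})
  rw [h1, mul_zero] at h2
  exact ae_iff.2 h2

lemma differentiable_ymu (hy : LipschitzWith K y) (hμ : μ ≠ 0) :
    Differentiable ℝ (ymu y μ) := by
  intro x
  have hcont (x : E dx) : Continuous fun u : E dx => y (x + μ • u) :=
    hy.continuous.comp (by fun_prop)
  refine (hasFDerivAt_integral_of_dominated_loc_of_lip (s := Set.univ)
    (F := fun x u => y (x + μ • u)) (F' := fun u => fderiv ℝ y (x + μ • u))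
    (bound := fun _ => (K : ℝ)) Filter.univ_mem
    (.of_forall fun x => (hcont x).aestronglyMeasurable)
    (integrable_comp_add_smul_uniformBall hy μ x) ?_ ?_ (integrable_const _) ?_).2.differentiableAt
  · exact ((measurable_fderiv ℝ y).comp (by fun_prop)).aestronglyMeasurable
  · refine .of_forall fun u => LipschitzWith.lipschitzOnWith <|
      LipschitzWith.of_dist_le_mul fun a b => ?_
    simpa using hy.dist_le_mul (a + μ • u) (b + μ • u)
  · filter_upwards [ae_differentiableAt_add_smul_uniformBall hy hμ x] with u hu
    exact (hasFDerivAt_comp_add_right (μ • u)).2 hu.hasFDerivAt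

lemma lipschitzWith_ymu (hy : LipschitzWith K y) (μ : ℝ) : LipschitzWith K (ymu y μ) := by
  refine LipschitzWith.of_dist_le_mul fun a b => ?_
  rw [dist_eq_norm, dist_eq_norm, ymu, ymu, ← integral_sub
    (integrable_comp_add_smul_uniformBall hy μ a) (integrable_comp_add_smul_uniformBall hy μ b)]
  refine (norm_integral_le_of_norm_le_const (C := K * ‖a - b‖) (.of_forall fun u => ?_)).trans ?_
  · simpa using hy.norm_sub_le (a + μ • u) (b + μ • u)
  · simp

lemma gradient_inner_ymu (hy : LipschitzWith K y) (hμ : μ ≠ 0) (v : E dy) (x : E dx) :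
    gradient (fun x => ∫ u, ⟪v, y (x + μ • u)⟫ ∂(uniformBall dx)) x
      = ContinuousLinearMap.adjoint (fderiv ℝ (ymu y μ) x) v := by
  have hfun : (fun x => ∫ u, ⟪v, y (x + μ • u)⟫ ∂(uniformBall dx))
      = fun x => innerSL ℝ v (ymu y μ x) := by
    funext x
    exact integral_inner (integrable_comp_add_smul_uniformBall hy μ x) v
  rw [hfun]
  refine HasGradientAt.gradient ?_
  rw [hasGradientAt_iff_hasFDerivAt]
  refine ((innerSL ℝ v).hasFDerivAt.comp x (differentiable_ymu hy hμ x).hasFDerivAt).congr_fderiv ?_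
  ext w
  simp [ContinuousLinearMap.adjoint_inner_left]

lemma lipschitzWith_inner_left (hy : LipschitzWith K y) (v : E dy) :
    LipschitzWith (‖v‖₊ * K) fun x => ⟪v, y x⟫ := by
  refine LipschitzWith.of_dist_le_mul fun a b => ?_
  rw [Real.dist_eq, ← inner_sub_right, dist_eq_norm]
  calc |⟪v, y a - y b⟫| ≤ ‖v‖ * ‖y a - y b‖ := abs_real_inner_le_norm _ _
    _ ≤ ‖v‖ * (K * ‖a - b‖) := by gcongr; exact hy.norm_sub_le a b
    _ = _ := by push_cast; ring

end Smoothing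

section PartialGradients

variable {dx dy : ℕ} {f : E dx × E dy → ℝ}

lemma gradx_eq (hf : Differentiable ℝ f) (x : E dx) (y : E dy) :
    gradx f x y = (InnerProductSpace.toDual ℝ (E dx)).symm
      ((fderiv ℝ f (x, y)).comp (ContinuousLinearMap.inl ℝ (E dx) (E dy))) := by
  rw [gradx, gradient]
  congr 1
  exact ((hf (x, y)).hasFDerivAt.comp x (hasFDerivAt_prodMk_left x y)).fderiv

lemma grady_eq (hf : Differentiable ℝ f) (x : E dx) (y : E dy) :
    grady f x y = (InnerProductSpace.toDual ℝ (E dy)).symm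
      ((fderiv ℝ f (x, y)).comp (ContinuousLinearMap.inr ℝ (E dx) (E dy))) := by
  rw [grady, gradient]
  congr 1
  exact ((hf (x, y)).hasFDerivAt.comp y (hasFDerivAt_prodMk_right x y)).fderiv

lemma norm_gradx_sub_le (hf : Differentiable ℝ f) (p q : E dx × E dy) :
    ‖gradx f p.1 p.2 - gradx f q.1 q.2‖ ≤ ‖fderiv ℝ f p - fderiv ℝ f q‖ := by
  rw [gradx_eq hf, gradx_eq hf, ← map_sub, LinearIsometryEquiv.norm_map,
    ← ContinuousLinearMap.sub_comp]
  exact (ContinuousLinearMap.opNorm_comp_le _ _).trans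
    (mul_le_of_le_one_right (norm_nonneg _) (ContinuousLinearMap.norm_inl_le_one ℝ (E dx) (E dy)))

lemma norm_grady_sub_le (hf : Differentiable ℝ f) (p q : E dx × E dy) :
    ‖grady f p.1 p.2 - grady f q.1 q.2‖ ≤ ‖fderiv ℝ f p - fderiv ℝ f q‖ := by
  rw [grady_eq hf, grady_eq hf, ← map_sub, LinearIsometryEquiv.norm_map,
    ← ContinuousLinearMap.sub_comp]
  exact (ContinuousLinearMap.opNorm_comp_le _ _).trans
    (mul_le_of_le_one_right (norm_nonneg _) (ContinuousLinearMap.norm_inr_le_one ℝ (E dx) (E dy)))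

lemma hasGradientAt_comp_graph (hf : Differentiable ℝ f) {g : E dx → E dy} {x : E dx}
    (hg : DifferentiableAt ℝ g x) :
    HasGradientAt (fun x => f (x, g x))
      (gradx f x (g x) + ContinuousLinearMap.adjoint (fderiv ℝ g x) (grady f x (g x))) x := by
  rw [hasGradientAt_iff_hasFDerivAt]
  refine ((hf (x, g x)).hasFDerivAt.comp x
    ((hasFDerivAt_id x).prodMk hg.hasFDerivAt)).congr_fderiv ?_
  ext1 w
  rw [InnerProductSpace.toDual_apply_apply, inner_add_left,
    ContinuousLinearMap.adjoint_inner_left, gradx_eq hf, grady_eq hf,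
    InnerProductSpace.toDual_symm_apply, InnerProductSpace.toDual_symm_apply,
    ContinuousLinearMap.comp_apply, ContinuousLinearMap.comp_apply, ContinuousLinearMap.comp_apply,
    ← map_add]
  simp

end PartialGradients

/-- the smoothed surrogate `F_μ(x) = f(x, y_μ(x))` is differentiable, its
gradient is `∇_x f(x, y_μ(x)) + Jac y_μ(x)ᵀ ∇_y f(x, y_μ(x))`, and it is Lipschitz with
constant `L_F = L_g(1+L_y)² + k₁ L_f L_y √d_x / μ`. -/
theorem stmt7 (dx dy : ℕ) (f : E dx × E dy → ℝ) (Lf Lg : ℝ≥0)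
    (hfdiff : Differentiable ℝ f)
    (hgradLip : ∀ p q : E dx × E dy, ‖fderiv ℝ f p - fderiv ℝ f q‖ ≤ (Lg : ℝ) * ‖p - q‖)
    (hgrady : ∀ (x : E dx) (y : E dy), ‖grady f x y‖ ≤ (Lf : ℝ))
    (ystar : E dx → E dy) (Ly : ℝ≥0) (hLip : LipschitzWith Ly ystar)
    (μ : ℝ) (hμ : 0 < μ) (k1 : ℝ) (hk1pos : 0 < k1)
    (hk1 : ∀ (L : ℝ≥0) (h : E dx → ℝ), LipschitzWith L h →
      ∀ a b : E dx,
        ‖gradient (fun x => ∫ u, h (x + μ • u) ∂(uniformBall dx)) a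
          - gradient (fun x => ∫ u, h (x + μ • u) ∂(uniformBall dx)) b‖
        ≤ k1 * (L : ℝ) * Real.sqrt dx / μ * ‖a - b‖) :
    Differentiable ℝ (Fmu f ystar μ) ∧
    (∀ x : E dx,
      gradient (Fmu f ystar μ) x
        = gradx f x (ymu ystar μ x)
          + (ContinuousLinearMap.adjoint (fderiv ℝ (ymu ystar μ) x))
              (grady f x (ymu ystar μ x))) ∧
    (∀ x z : E dx,
      ‖gradient (Fmu f ystar μ) x - gradient (Fmu f ystar μ) z‖
        ≤ ((Lg : ℝ) * (1 + (Ly : ℝ)) ^ 2 + k1 * (Lf : ℝ) * (Ly : ℝ) * Real.sqrt dx / μ)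
            * ‖x - z‖) := by
  have hJ : Differentiable ℝ (ymu ystar μ) := differentiable_ymu hLip hμ.ne'
  have hF (x : E dx) := hasGradientAt_comp_graph hfdiff (hJ x)
  refine ⟨fun x => (hF x).differentiableAt, fun x => (hF x).gradient, fun x z => ?_⟩
  have hgx : gradient (Fmu f ystar μ) x = _ := (hF x).gradient
  have hgz : gradient (Fmu f ystar μ) z = _ := (hF z).gradient
  rw [hgx, hgz]
  set Jx := ContinuousLinearMap.adjoint (fderiv ℝ (ymu ystar μ) x)
  set Jz := ContinuousLinearMap.adjoint (fderiv ℝ (ymu ystar μ) z)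
  set p : E dx × E dy := (x, ymu ystar μ x) with hp
  set q : E dx × E dy := (z, ymu ystar μ z) with hq
  have hJx : ‖Jx‖ ≤ Ly := by
    rw [LinearIsometryEquiv.norm_map]
    exact norm_fderiv_le_of_lipschitz ℝ (lipschitzWith_ymu hLip μ)
  have hpq : ‖p - q‖ ≤ (1 + (Ly : ℝ)) * ‖x - z‖ := by
    refine norm_prod_le_iff.2 ⟨?_, ((lipschitzWith_ymu hLip μ).norm_sub_le x z).trans ?_⟩
    · exact le_mul_of_one_le_left (norm_nonneg _) (by simp)
    · gcongr
      simp
  have hD : ‖fderiv ℝ f p - fderiv ℝ f q‖ ≤ Lg * ((1 + (Ly : ℝ)) * ‖x - z‖) :=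
    (hgradLip p q).trans (by gcongr)
  have hA := (norm_gradx_sub_le hfdiff p q).trans hD
  have hB : ‖Jx (grady f p.1 p.2 - grady f q.1 q.2)‖
      ≤ Ly * (Lg * ((1 + (Ly : ℝ)) * ‖x - z‖)) :=
    Jx.le_of_opNorm_le_of_le hJx ((norm_grady_sub_le hfdiff p q).trans hD)
  have hC : ‖Jx (grady f q.1 q.2) - Jz (grady f q.1 q.2)‖
      ≤ k1 * Lf * Ly * Real.sqrt dx / μ * ‖x - z‖ := by
    have h := hk1 _ _ (lipschitzWith_inner_left hLip (grady f q.1 q.2)) x z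
    rw [gradient_inner_ymu hLip hμ.ne', gradient_inner_ymu hLip hμ.ne'] at h
    refine h.trans ?_
    have hv := hgrady q.1 q.2
    rw [NNReal.coe_mul, coe_nnnorm, ← mul_assoc k1]
    gcongr
  calc _ = ‖(gradx f p.1 p.2 - gradx f q.1 q.2) + Jx (grady f p.1 p.2 - grady f q.1 q.2)
        + (Jx (grady f q.1 q.2) - Jz (grady f q.1 q.2))‖ := by
        rw [map_sub]
        congr 1
        simp only [hp, hq]
        abel
    _ ≤ _ := norm_add₃_le
    _ ≤ Lg * ((1 + (Ly : ℝ)) * ‖x - z‖) + Ly * (Lg * ((1 + (Ly : ℝ)) * ‖x - z‖))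
        + k1 * Lf * Ly * Real.sqrt dx / μ * ‖x - z‖ := add_le_add_three hA hB hC
    _ = _ := by ring
end
end

section
/- Let f : ℝ^{d_x} × ℝ^{d_y} → ℝ be differentiable with ‖∇_x f(x,y)‖ ≤ L_f and ‖∇_y f(x,y)‖ ≤ L_f for all (x,y), and let y* : ℝ^{d_x} → ℝ^{d_y} be L_y-Lipschitz. Let μ > 0 and suppose k₂ > 0 is a constant with the property that for every L-Lipschitz scalar function h : ℝ^{d_x} → ℝ, every x and every μ > 0, E_{v ~ U(S^{d_x})}‖(d_x/2μ)(h(x+μv) − h(x−μv)) v‖² ≤ k₂ d_x L². Fix x ∈ ℝ^{d_x} and define, for v ∈ S^{d_x}, the estimator g(v) = ∇_x f(x, y*(x)) + H(v)ᵀ ∇_y f(x, y*(x)) with H(v) = (d_x/2μ)(y*(x+μv) − y*(x−μv)) vᵀ. Then E_{v ~ U(S^{d_x})}[‖g(v)‖²] ≤ k₂ d_x L_f² L_y² + L_f²(1 + 2L_y). -/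
open MeasureTheory Metric
open scoped InnerProductSpace RealInnerProductSpace NNReal

noncomputable section

open scoped Pointwise in
lemma map_linearIsometryEquiv_map_val_toSphere {n : ℕ} (U : E n ≃ₗᵢ[ℝ] E n) :
    (Measure.map Subtype.val (volume : Measure (E n)).toSphere).map U =
      Measure.map Subtype.val (volume : Measure (E n)).toSphere := by
  ext s hs
  have hUs : MeasurableSet (U ⁻¹' s) := U.continuous.measurable hs
  rw [Measure.map_apply U.continuous.measurable hs,
    Measure.map_apply measurable_subtype_coe hUs, Measure.map_apply measurable_subtype_coe hs,
    Measure.toSphere_apply' _ (measurable_subtype_coe hUs),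
    Measure.toSphere_apply' _ (measurable_subtype_coe hs)]
  have key : Set.Ioo (0 : ℝ) 1 • (Subtype.val '' (Subtype.val ⁻¹' (U ⁻¹' s) :
        Set (sphere (0 : E n) 1))) =
      U ⁻¹' (Set.Ioo (0 : ℝ) 1 • (Subtype.val '' (Subtype.val ⁻¹' s :
        Set (sphere (0 : E n) 1)))) := by
    ext z
    simp only [Set.mem_smul, Set.mem_preimage, Subtype.image_preimage_coe, Set.mem_inter_iff,
      mem_sphere_zero_iff_norm]
    constructor
    · rintro ⟨r, hr, v, ⟨hv, hv'⟩, rfl⟩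
      exact ⟨r, hr, U v, ⟨by simpa using hv, by assumption⟩, by simp⟩
    · rintro ⟨r, hr, w, ⟨hw, hw'⟩, h⟩
      refine ⟨r, hr, U.symm w, ⟨by simpa using hw, by simpa using hw'⟩, ?_⟩
      rw [← map_smul, h, U.symm_apply_apply]
  rw [key]
  congr 1
  exact MeasurePreserving.measure_preimage_equiv (f := U.toMeasurableEquiv) U.measurePreserving _

/-- The uniform measure on the sphere is invariant under linear isometries. -/
lemma map_linearIsometryEquiv_uniformSphere {n : ℕ} (U : E n ≃ₗᵢ[ℝ] E n) :
    (uniformSphere n).map U = uniformSphere n := by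
  rw [uniformSphere, Measure.map_smul, map_linearIsometryEquiv_map_val_toSphere]

lemma integral_comp_linearIsometryEquiv_uniformSphere {n : ℕ} (U : E n ≃ₗᵢ[ℝ] E n)
    (F : E n → ℝ) :
    ∫ v, F (U v) ∂(uniformSphere n) = ∫ v, F v ∂(uniformSphere n) := by
  conv_rhs => rw [← map_linearIsometryEquiv_uniformSphere U]
  exact (U.toHomeomorph.measurableEmbedding.integral_map F).symm

lemma isProbabilityMeasure_uniformSphere {n : ℕ} (hn : 0 < n) :
    IsProbabilityMeasure (uniformSphere n) := by
  have : Nonempty (Fin n) := ⟨⟨0, hn⟩⟩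
  refine ⟨?_⟩
  rw [uniformSphere, Measure.smul_apply, Measure.map_apply measurable_subtype_coe .univ,
    Set.preimage_univ, smul_eq_mul]
  exact ENNReal.inv_mul_cancel (Measure.measure_univ_ne_zero.2
    (Measure.toSphere_ne_zero (volume : Measure (E n)))) (measure_ne_top _ _)

lemma ae_norm_eq_one_uniformSphere (n : ℕ) : ∀ᵐ v ∂(uniformSphere n), ‖v‖ = 1 := by
  refine Measure.ae_smul_measure ?_ _
  rw [(MeasurableEmbedding.subtype_coe isClosed_sphere.measurableSet).ae_map_iff]
  exact .of_forall fun v => by simp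

lemma integrable_uniformSphere_of_continuous {n : ℕ} (hn : 0 < n) {F : E n → ℝ}
    (hF : Continuous F) : Integrable F (uniformSphere n) := by
  have := isProbabilityMeasure_uniformSphere hn
  obtain ⟨C, hC⟩ := (isCompact_sphere (0 : E n) 1).exists_bound_of_continuousOn hF.continuousOn
  refine Integrable.of_bound hF.aestronglyMeasurable C ?_
  filter_upwards [ae_norm_eq_one_uniformSphere n] with v hv
  exact hC v (by simpa using hv)

/-- The second moment of the uniform measure on the sphere is isotropic. -/
lemma integral_inner_sq_uniformSphere {n : ℕ} (hn : 0 < n) (a : E n) :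
    ∫ v, (inner ℝ a v) ^ 2 ∂(uniformSphere n) = ‖a‖ ^ 2 / n := by
  have := isProbabilityMeasure_uniformSphere hn
  have hn' : (n : ℝ) ≠ 0 := by positivity
  have hbasis (i : Fin n) : ∫ v, (inner ℝ a v) ^ 2 ∂(uniformSphere n) =
      ‖a‖ ^ 2 * ∫ v, (v i) ^ 2 ∂(uniformSphere n) := by
    set b : E n := ‖a‖ • EuclideanSpace.single i (1 : ℝ)
    have hb : ‖b‖ = ‖a‖ := by simp [b, norm_smul]
    set U := (ℝ ∙ (b - a))ᗮ.reflection
    have hU : U b = a := Submodule.reflection_sub hb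
    rw [← integral_comp_linearIsometryEquiv_uniformSphere U, ← integral_const_mul]
    congr 1 with v
    rw [← hU, U.inner_map_map, real_inner_smul_left, EuclideanSpace.inner_single_left, hU]
    simp [mul_pow]
  have hsum : ∑ i : Fin n, ∫ v, (v i) ^ 2 ∂(uniformSphere n) = 1 := by
    rw [← integral_finsetSum _ fun i _ =>
      integrable_uniformSphere_of_continuous hn (by fun_prop)]
    have : (fun v : E n => ∑ i, (v i) ^ 2) =ᵐ[uniformSphere n] fun _ => 1 := by
      filter_upwards [ae_norm_eq_one_uniformSphere n] with v hv
      rw [← EuclideanSpace.real_norm_sq_eq, hv, one_pow]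
    rw [integral_congr_ae this]
    simp
  have := Finset.sum_congr rfl fun i (_ : i ∈ Finset.univ) => hbasis i
  rw [← Finset.mul_sum, hsum] at this
  simp only [Finset.sum_const, Finset.card_univ, Fintype.card_fin, nsmul_eq_mul] at this
  rw [eq_div_iff hn']
  linarith

/-- Testing a Lipschitz function against a linear form on the sphere gains a factor `1 / n`, by
symmetrizing with the reflection along the linear form. -/
lemma abs_integral_mul_inner_uniformSphere_le {n : ℕ} (hn : 0 < n) {K : ℝ≥0} {φ : E n → ℝ}
    (hφ : LipschitzWith K φ) (a : E n) :
    |∫ v, φ v * inner ℝ a v ∂(uniformSphere n)| ≤ K * ‖a‖ / n := by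
  rcases eq_or_ne a 0 with rfl | ha
  · simp
  have ha' : 0 < ‖a‖ := norm_pos_iff.mpr ha
  have hc := hφ.continuous
  set U := (ℝ ∙ a)ᗮ.reflection
  have hUv (v : E n) : v - U v = (2 * inner ℝ a v / ‖a‖ ^ 2) • a := by
    rw [Submodule.reflection_orthogonal_apply, Submodule.reflection_singleton_apply, two_smul]
    simp only [RCLike.ofReal_real_eq_id, id]
    module
  have hUa (v : E n) : inner ℝ a (U v) = -inner ℝ a v := by
    have h := congrArg (inner ℝ a) (hUv v)
    rw [inner_sub_right, real_inner_smul_right, real_inner_self_eq_norm_sq] at h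
    field_simp at h
    linarith
  have hsymm : ∫ v, φ v * inner ℝ a v ∂(uniformSphere n) =
      ∫ v, (φ v - φ (U v)) * inner ℝ a v / 2 ∂(uniformSphere n) := by
    have h := integral_comp_linearIsometryEquiv_uniformSphere U fun v => φ v * inner ℝ a v
    have h₁ : Integrable (fun v => φ v * inner ℝ a v) (uniformSphere n) :=
      integrable_uniformSphere_of_continuous hn (by fun_prop)
    have h₂ : Integrable (fun v => φ (U v) * inner ℝ a (U v)) (uniformSphere n) :=
      integrable_uniformSphere_of_continuous hn (by fun_prop)
    have h₃ : ∀ v, (φ v - φ (U v)) * inner ℝ a v / 2 =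
        (φ v * inner ℝ a v + φ (U v) * inner ℝ a (U v)) / 2 := fun v => by
      rw [hUa]; ring
    simp_rw [h₃]
    rw [integral_div, integral_add h₁ h₂, h]
    ring
  have hpt (v : E n) :
      ‖(φ v - φ (U v)) * inner ℝ a v / 2‖ ≤ K / ‖a‖ * (inner ℝ a v) ^ 2 := by
    have h := hφ.dist_le_mul v (U v)
    rw [dist_eq_norm, dist_eq_norm, hUv, norm_smul, norm_div, norm_mul, norm_pow, norm_norm,
      Real.norm_ofNat] at h
    rw [norm_div, norm_mul, Real.norm_ofNat]
    calc _ ≤ (K * (2 * ‖inner ℝ a v‖ / ‖a‖ ^ 2 * ‖a‖)) * ‖inner ℝ a v‖ / 2 := by gcongr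
      _ = K / ‖a‖ * ‖inner ℝ a v‖ ^ 2 := by field_simp
      _ = _ := by rw [Real.norm_eq_abs, sq_abs]
  rw [hsymm, ← Real.norm_eq_abs]
  refine (norm_integral_le_of_norm_le (integrable_uniformSphere_of_continuous hn
    (by fun_prop)) (.of_forall hpt)).trans_eq ?_
  rw [integral_const_mul, integral_inner_sq_uniformSphere hn]
  field_simp

lemma adjoint_smul_smulRight_apply {n m : ℕ} (c : ℝ) (v : E n) (y w : E m) :
    ContinuousLinearMap.adjoint (c • (innerSL ℝ v).smulRight y) w =
      (c * inner ℝ w y) • v := by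
  refine ext_inner_left ℝ fun z => ?_
  rw [ContinuousLinearMap.adjoint_inner_right]
  simp only [smul_apply, ContinuousLinearMap.smulRight_apply,
    innerSL_apply_apply, real_inner_smul_left, real_inner_smul_right]
  rw [real_inner_comm z v, real_inner_comm w y]
  ring

/-- second-moment bound for the PZOS estimator
`g(v) = ∇_x f(x, y*(x)) + H(v)ᵀ ∇_y f(x, y*(x))`, where
`H(v) = (d_x/2μ)(y*(x+μv) − y*(x−μv)) vᵀ`:
`E_v[‖g(v)‖²] ≤ k₂ d_x L_f² L_y² + L_f²(1 + 2L_y)`. -/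
theorem stmt10 (dx dy : ℕ) (f : E dx × E dy → ℝ) (Lf : ℝ≥0)
    (hfdiff : Differentiable ℝ f)
    (hgradx : ∀ (x : E dx) (y : E dy), ‖gradx f x y‖ ≤ (Lf : ℝ))
    (hgrady : ∀ (x : E dx) (y : E dy), ‖grady f x y‖ ≤ (Lf : ℝ))
    (ystar : E dx → E dy) (Ly : ℝ≥0) (hLip : LipschitzWith Ly ystar)
    (μ : ℝ) (hμ : 0 < μ) (k2 : ℝ) (hk2pos : 0 < k2)
    (hk2 : ∀ (L : ℝ≥0) (h : E dx → ℝ), LipschitzWith L h →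
      ∀ (z : E dx) (μ' : ℝ), 0 < μ' →
        (∫ v, ‖(((dx : ℝ) / (2 * μ')) * (h (z + μ' • v) - h (z - μ' • v))) • v‖ ^ 2
          ∂(uniformSphere dx))
        ≤ k2 * (dx : ℝ) * (L : ℝ) ^ 2)
    (x : E dx) :
    (∫ v, ‖gradx f x (ystar x)
        + (ContinuousLinearMap.adjoint
            (((dx : ℝ) / (2 * μ)) •
              ((innerSL ℝ v).smulRight (ystar (x + μ • v) - ystar (x - μ • v)))))
            (grady f x (ystar x))‖ ^ 2 ∂(uniformSphere dx))
      ≤ k2 * (dx : ℝ) * (Lf : ℝ) ^ 2 * (Ly : ℝ) ^ 2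
        + (Lf : ℝ) ^ 2 * (1 + 2 * (Ly : ℝ)) := by
  rcases Nat.eq_zero_or_pos dx with rfl | hn
  · have : uniformSphere 0 = 0 := by
      rw [uniformSphere, (Measure.toSphere_eq_zero_iff_finrank (volume : Measure (E 0))).2
        (by simp)]
      simp
    rw [this, integral_zero_measure]
    positivity
  have := isProbabilityMeasure_uniformSphere hn
  have hn' : (0 : ℝ) < dx := by exact_mod_cast hn
  set a := gradx f x (ystar x)
  set w := grady f x (ystar x)
  have ha : ‖a‖ ≤ Lf := hgradx _ _
  have hw : ‖w‖ ≤ Lf := hgrady _ _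
  set h : E dx → ℝ := fun z => inner ℝ w (ystar z)
  have hh : LipschitzWith (Lf * Ly) h := LipschitzWith.of_dist_le_mul fun p q => by
    rw [dist_eq_norm, ← inner_sub_right, NNReal.coe_mul, mul_assoc]
    refine (norm_inner_le_norm _ _).trans ?_
    gcongr
    rw [← dist_eq_norm]
    exact hLip.dist_le_mul p q
  have hhc := hh.continuous
  set φ : E dx → ℝ := fun v => h (x + μ • v) - h (x - μ • v)
  have hφ : LipschitzWith (2 * μ.toNNReal * (Lf * Ly)) φ :=
    LipschitzWith.of_dist_le_mul fun p q => by
      have h₁ := hh.dist_le_mul (x + μ • p) (x + μ • q)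
      have h₂ := hh.dist_le_mul (x - μ • p) (x - μ • q)
      rw [dist_add_left, dist_smul₀, Real.norm_of_nonneg hμ.le] at h₁
      rw [dist_sub_left, dist_smul₀, Real.norm_of_nonneg hμ.le] at h₂
      refine (dist_sub_sub_le _ _ _ _).trans ?_
      simp only [NNReal.coe_mul, NNReal.coe_ofNat, Real.coe_toNNReal _ hμ.le] at h₁ h₂ ⊢
      linarith
  have hφc := hφ.continuous
  have hcross : dx / (2 * μ) * ∫ v, φ v * inner ℝ a v ∂(uniformSphere dx) ≤ Lf ^ 2 * Ly := by
    have h₁ := (le_abs_self _).trans (abs_integral_mul_inner_uniformSphere_le hn hφ a)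
    simp only [NNReal.coe_mul, NNReal.coe_ofNat, Real.coe_toNNReal _ hμ.le] at h₁
    calc _ ≤ dx / (2 * μ) * (2 * μ * (Lf * Ly) * ‖a‖ / dx) := by gcongr
      _ = Lf * Ly * ‖a‖ := by field_simp
      _ ≤ Lf * Ly * Lf := by gcongr
      _ = _ := by ring
  have hexpand (v : E dx) :
      ‖a + (ContinuousLinearMap.adjoint (((dx : ℝ) / (2 * μ)) •
          ((innerSL ℝ v).smulRight (ystar (x + μ • v) - ystar (x - μ • v))))) w‖ ^ 2 =
        ‖a‖ ^ 2 + 2 * (dx / (2 * μ)) * (φ v * inner ℝ a v) +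
          ‖((dx : ℝ) / (2 * μ) * φ v) • v‖ ^ 2 := by
    rw [adjoint_smul_smulRight_apply, inner_sub_right, norm_add_sq_real, real_inner_smul_right]
    ring
  simp_rw [hexpand]
  rw [integral_add (integrable_uniformSphere_of_continuous hn (by fun_prop))
      (integrable_uniformSphere_of_continuous hn (by fun_prop)),
    integral_add (integrable_uniformSphere_of_continuous hn (by fun_prop))
      (integrable_uniformSphere_of_continuous hn (by fun_prop)),
    integral_const_mul, integral_const, probReal_univ, one_smul]
  have hvar := hk2 _ h hh x μ hμ
  rw [NNReal.coe_mul] at hvar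
  have ha2 : ‖a‖ ^ 2 ≤ (Lf : ℝ) ^ 2 := by gcongr
  linarith
end
end
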